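/- arXiv:2510.06765 — 2 statements merged into one kernel-verified Lean document; each statement's English description precedes it below -/
import Mathlib

section
/- There exists a smooth concave increasing function $f:[0,\infty)\to[0,\infty)$ with $f(t)=t$ on $[0,1]$ and a sequence $1=R_0<R_1<R_2<\cdots$ with $R_{j+1}>(R_j+1)^2+1$ such that for every $l\in\mathbb{N}_+$, $f(t)=t^{1/(l+1)}$ for $t\in[R_{4l-3}+1,R_{4l-2}-1]$ and $f(t)=t^{1-1/(l+1)}$ for $t\in[R_{4l-1}+1,R_{4l}-1]$. -/
open Set

open Filter Topology

/-- A smooth convex approximation of `s ↦ max 0 s`, equal to it outside `(-1, 1)`. -/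
theorem exists_smooth_convex_ramp : ∃ ψ ψ' ψ'' : ℝ → ℝ, ContDiff ℝ (⊤ : ℕ∞) ψ ∧
    (∀ s, HasDerivAt ψ (ψ' s) s) ∧ (∀ s, HasDerivAt ψ' (ψ'' s) s) ∧
    (∀ s, 0 ≤ ψ' s) ∧ (∀ s, ψ' s ≤ 1) ∧ (∀ s, 0 ≤ ψ'' s) ∧
    (∀ s ≤ -1, ψ s = 0) ∧ (∀ s, 1 ≤ s → ψ s = s) := by
  have hcont := Real.smoothTransition.continuous
  have hint : ∀ a b : ℝ, IntervalIntegrable Real.smoothTransition MeasureTheory.volume a b :=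
    fun a b => hcont.intervalIntegrable a b
  have hsm : ContDiff ℝ (⊤ : ℕ∞) Real.smoothTransition := Real.smoothTransition.contDiff
  set I : ℝ := ∫ x in (0 : ℝ)..1, Real.smoothTransition x with hI
  have hI1 : I ≤ 1 := by
    have := intervalIntegral.integral_mono_on (zero_le_one' ℝ) (hint 0 1)
      (intervalIntegrable_const (c := (1 : ℝ))) fun x _ => Real.smoothTransition.le_one x
    simpa using this
  have hI0 : 0 ≤ I :=
    intervalIntegral.integral_nonneg zero_le_one fun x _ => Real.smoothTransition.nonneg x
  have hd : ∀ s, HasDerivAt (fun s : ℝ => ∫ x in (0 : ℝ)..(s + (1 - I)), Real.smoothTransition x)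
      (Real.smoothTransition (s + (1 - I))) s := fun s =>
    (intervalIntegral.integral_hasDerivAt_right (hint 0 _)
      (hcont.stronglyMeasurableAtFilter _ _) hcont.continuousAt).comp_add_const s (1 - I)
  refine ⟨fun s => ∫ x in (0 : ℝ)..(s + (1 - I)), Real.smoothTransition x,
    fun s => Real.smoothTransition (s + (1 - I)),
    fun s => deriv Real.smoothTransition (s + (1 - I)), ?_, hd, ?_,
    fun s => Real.smoothTransition.nonneg _, fun s => Real.smoothTransition.le_one _,
    fun s => Real.smoothTransition.monotone.deriv_nonneg, ?_, ?_⟩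
  · rw [contDiff_infty_iff_deriv]
    refine ⟨fun s => (hd s).differentiableAt, ?_⟩
    rw [funext fun s => (hd s).deriv]
    exact hsm.comp (contDiff_id.add contDiff_const)
  · intro s
    exact ((hsm.differentiable (by simp)) _).hasDerivAt.comp_add_const s (1 - I)
  · intro s hs
    have hle : s + (1 - I) ≤ 0 := by linarith
    have : EqOn Real.smoothTransition (fun _ => 0) (uIcc 0 (s + (1 - I))) := by
      intro x hx
      rw [uIcc_of_ge hle] at hx
      exact Real.smoothTransition.zero_of_nonpos hx.2
    simp [intervalIntegral.integral_congr this]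
  · intro s hs
    have hle : 1 ≤ s + (1 - I) := by linarith
    have : EqOn Real.smoothTransition (fun _ => 1) (uIcc 1 (s + (1 - I))) := by
      intro x hx
      rw [uIcc_of_le hle] at hx
      exact Real.smoothTransition.one_of_one_le hx.1
    simp only []
    rw [← intervalIntegral.integral_add_adjacent_intervals (hint 0 1) (hint 1 _),
      intervalIntegral.integral_congr this, ← hI]
    simp
    ring

/-- `f` is smooth at `x`, with positive derivative and nonpositive second derivative. -/
def SmoothIncConcaveAt (f : ℝ → ℝ) (x : ℝ) : Prop :=
  ContDiffAt ℝ (⊤ : ℕ∞) f x ∧ 0 < deriv f x ∧ deriv (deriv f) x ≤ 0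

namespace SmoothIncConcaveAt

variable {f g u v : ℝ → ℝ} {x : ℝ}

theorem hasDerivAt (h : SmoothIncConcaveAt f x) : HasDerivAt f (deriv f x) x :=
  (h.1.differentiableAt (by simp)).hasDerivAt

theorem hasDerivAt_deriv (h : SmoothIncConcaveAt f x) :
    HasDerivAt (deriv f) (deriv (deriv f) x) x :=
  ((h.1.derivWithin (m := (⊤ : ℕ∞)) le_rfl).differentiableAt (by simp)).hasDerivAt

theorem congr (h : SmoothIncConcaveAt f x) (hfg : g =ᶠ[𝓝 x] f) : SmoothIncConcaveAt g x := by
  refine ⟨h.1.congr_of_eventuallyEq hfg, ?_, ?_⟩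
  · rw [hfg.deriv_eq]
    exact h.2.1
  · rw [hfg.deriv.deriv_eq]
    exact h.2.2

theorem of_hasDerivAt {f' : ℝ → ℝ} {f'' : ℝ} (hf : ContDiffAt ℝ (⊤ : ℕ∞) f x)
    (h1 : ∀ᶠ y in 𝓝 x, HasDerivAt f (f' y) y) (h2 : HasDerivAt f' f'' x) (hpos : 0 < f' x)
    (hneg : f'' ≤ 0) : SmoothIncConcaveAt f x := by
  have he : deriv f =ᶠ[𝓝 x] f' := h1.mono fun y hy => hy.deriv
  refine ⟨hf, ?_, ?_⟩
  · rwa [he.eq_of_nhds]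
  · rwa [he.deriv_eq, h2.deriv]

theorem affine {m : ℝ} (hm : 0 < m) (a c : ℝ) :
    SmoothIncConcaveAt (fun t => c + m * (t - a)) x := by
  refine of_hasDerivAt (f' := fun _ => m) (f'' := 0) (by fun_prop) (.of_forall fun y => ?_)
    (hasDerivAt_const _ _) hm le_rfl
  simpa using (((hasDerivAt_id y).sub_const a).const_mul m).const_add c

theorem rpow {b : ℝ} (hb0 : 0 < b) (hb1 : b ≤ 1) (hx : 0 < x) :
    SmoothIncConcaveAt (fun t => t ^ b) x := by
  refine of_hasDerivAt (f' := fun t => b * t ^ (b - 1))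
    (f'' := b * ((b - 1) * x ^ (b - 1 - 1)))
    (Real.contDiffAt_rpow_const_of_ne hx.ne')
    ((eventually_gt_nhds hx).mono fun y hy => Real.hasDerivAt_rpow_const (Or.inl hy.ne'))
    ((Real.hasDerivAt_rpow_const (Or.inl hx.ne')).const_mul b) (by positivity) ?_
  have h : 0 ≤ x ^ (b - 1 - 1) := by positivity
  exact mul_nonpos_of_nonneg_of_nonpos hb0.le
    (mul_nonpos_of_nonpos_of_nonneg (by linarith) h)

/-- If `f` and `g` cross transversally at `x`, the corner of `min f g` at `x` can be smoothed. -/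
theorem exists_smooth_corner {ε : ℝ} (hε : 0 < ε)
    (hu : ∀ t < x + ε, SmoothIncConcaveAt u t) (hv : ∀ t > x - ε, SmoothIncConcaveAt v t)
    (hx : u x = v x) (hd : deriv v x < deriv u x) :
    ∃ w : ℝ → ℝ, (∀ t, SmoothIncConcaveAt w t) ∧ (∀ t ≤ x - ε, w t = u t) ∧
      ∀ t, x + ε ≤ t → w t = v t := by
  obtain ⟨ψ, ψ', ψ'', hψ, hψ1, hψ2, hψ'0, hψ'1, hψ'', hψl, hψr⟩ := exists_smooth_convex_ramp
  have hdx : HasDerivAt (fun t => u t - v t) (deriv u x - deriv v x) x :=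
    (hu x (by linarith)).hasDerivAt.sub (hv x (by linarith)).hasDerivAt
  have hsign : ∀ᶠ t in 𝓝 x, (t < x → u t - v t < 0) ∧ (x < t → 0 < u t - v t) := by
    have := hdx.tendsto_slope.eventually (eventually_gt_nhds (sub_pos.2 hd))
    rw [eventually_nhdsWithin_iff] at this
    filter_upwards [this] with t ht
    constructor
    · intro h
      have h1 := ht (ne_of_lt h)
      rw [slope_def_field, hx, sub_self, sub_zero] at h1
      by_contra! h2
      exact absurd h1 (not_lt.2 (div_nonpos_of_nonneg_of_nonpos h2 (by linarith)))
    · intro h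
      have h1 := ht (ne_of_gt h)
      rw [slope_def_field, hx, sub_self, sub_zero] at h1
      exact (div_pos_iff_of_pos_right (by linarith)).1 h1
  obtain ⟨ρ, hρ, hball⟩ := Metric.eventually_nhds_iff.1 hsign
  obtain ⟨η, hη0, hη⟩ := exists_between (lt_min hε hρ)
  have hηε := hη.trans_le (min_le_left _ _)
  have hηρ := hη.trans_le (min_le_right _ _)
  have hl : u (x - η) - v (x - η) < 0 :=
    (hball (by simpa [Real.dist_eq, abs_of_pos hη0] using hηρ)).1 (by linarith)
  have hr : 0 < u (x + η) - v (x + η) :=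
    (hball (by simpa [Real.dist_eq, abs_of_pos hη0] using hηρ)).2 (by linarith)
  obtain ⟨δ, hδ0, hδ⟩ := exists_between (lt_min (neg_pos.2 hl) hr)
  have hδl := hδ.trans_le (min_le_left _ _)
  have hδr := hδ.trans_le (min_le_right _ _)
  set m : ℝ → ℝ := fun t => u t - δ * ψ ((u t - v t) / δ) with hm
  have hcu : ∀ t, x - ε < t → t < x + ε → ContinuousAt (fun t => u t - v t) t :=
    fun t h1 h2 => (hu t h2).1.continuousAt.sub (hv t h1).1.continuousAt
  have hml : m =ᶠ[𝓝 (x - η)] u := by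
    filter_upwards [(hcu (x - η) (by linarith) (by linarith)).eventually
      (eventually_lt_nhds (b := -δ) (by linarith))] with t ht
    have : (u t - v t) / δ ≤ -1 := by
      rw [div_le_iff₀ hδ0]
      linarith
    simp [hm, hψl _ this]
  have hmr : m =ᶠ[𝓝 (x + η)] v := by
    filter_upwards [(hcu (x + η) (by linarith) (by linarith)).eventually
      (eventually_gt_nhds (b := δ) (by linarith))] with t ht
    have : 1 ≤ (u t - v t) / δ := by
      rw [le_div_iff₀ hδ0]
      linarith
    simp only [hm, hψr _ this]
    field_simp
    ring
  have hmm : ∀ t, x - ε < t → t < x + ε → SmoothIncConcaveAt m t := by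
    intro t h1 h2
    have hut := hu t h2
    have hvt := hv t h1
    have hψd : ∀ s, x - ε < s → s < x + ε → HasDerivAt (fun s => (u s - v s) / δ)
        ((deriv u s - deriv v s) / δ) s := fun s h1 h2 =>
      ((hu s h2).hasDerivAt.sub (hv s h1).hasDerivAt).div_const δ
    refine of_hasDerivAt
      (f' := fun s => deriv u s - ψ' ((u s - v s) / δ) * (deriv u s - deriv v s))
      (f'' := deriv (deriv u) t - (ψ'' ((u t - v t) / δ) * ((deriv u t - deriv v t) / δ) *
        (deriv u t - deriv v t) + ψ' ((u t - v t) / δ) *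
          (deriv (deriv u) t - deriv (deriv v) t))) ?_ ?_ ?_ ?_ ?_
    · exact hut.1.sub (contDiffAt_const.mul
        (hψ.contDiffAt.comp t ((hut.1.sub hvt.1).div_const δ)))
    · filter_upwards [Ioo_mem_nhds h1 h2] with s hs
      have := (hu s hs.2).hasDerivAt.sub
        (((hψ1 _).comp s (hψd s hs.1 hs.2)).const_mul δ)
      refine this.congr_deriv ?_
      field_simp
    · exact hut.hasDerivAt_deriv.sub (((hψ2 _).comp t (hψd t h1 h2)).mul
        (hut.hasDerivAt_deriv.sub hvt.hasDerivAt_deriv))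
    · have hp := hut.2.1
      have hq := hvt.2.1
      have h0 := hψ'0 ((u t - v t) / δ)
      have h1 := hψ'1 ((u t - v t) / δ)
      rcases h0.eq_or_lt with h0 | h0
      · simp only [← h0]
        linarith
      · nlinarith [mul_pos h0 hq, mul_nonneg (sub_nonneg.2 h1) hp.le]
    · have hp := hut.2.2
      have hq := hvt.2.2
      have h0 := hψ'0 ((u t - v t) / δ)
      have h1 := hψ'1 ((u t - v t) / δ)
      have h3 : 0 ≤ ψ'' ((u t - v t) / δ) * ((deriv u t - deriv v t) / δ) *
          (deriv u t - deriv v t) := by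
        have : ψ'' ((u t - v t) / δ) * ((deriv u t - deriv v t) / δ) * (deriv u t - deriv v t) =
          ψ'' ((u t - v t) / δ) * ((deriv u t - deriv v t) ^ 2 / δ) := by ring
        rw [this]
        exact mul_nonneg (hψ'' _) (by positivity)
      nlinarith [mul_nonpos_of_nonneg_of_nonpos h0 hq,
        mul_nonpos_of_nonneg_of_nonpos (sub_nonneg.2 h1) hp]
  refine ⟨fun t => if t ≤ x - η then u t else if t ≤ x + η then m t else v t, fun t => ?_,
    fun t ht => if_pos (by linarith), fun t ht => ?_⟩
  · rcases lt_trichotomy t (x - η) with h | h | h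
    · refine (hu t (by linarith)).congr ?_
      filter_upwards [eventually_lt_nhds h] with s hs
      exact if_pos hs.le
    · subst h
      refine (hu (x - η) (by linarith)).congr ?_
      filter_upwards [hml, eventually_lt_nhds (show x - η < x + η by linarith)] with s hs hs'
      split_ifs
      · rfl
      · exact hs
      · linarith
    rcases lt_trichotomy t (x + η) with h' | h' | h'
    · refine (hmm t (by linarith) (by linarith)).congr ?_
      filter_upwards [Ioo_mem_nhds h h'] with s hs
      rw [if_neg (not_le.2 hs.1), if_pos hs.2.le]
    · subst h'
      refine (hv (x + η) (by linarith)).congr ?_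
      filter_upwards [hmr, eventually_gt_nhds h] with s hs hs'
      rw [if_neg (not_le.2 hs')]
      split_ifs
      · exact hs
      · rfl
    · refine (hv t (by linarith)).congr ?_
      filter_upwards [eventually_gt_nhds h, eventually_gt_nhds h'] with s hs hs'
      rw [if_neg (not_le.2 hs), if_neg (not_le.2 hs')]
  · have h1 : ¬t ≤ x - η := by linarith
    have h2 : ¬t ≤ x + η := by linarith
    simp only [h1, h2, if_false]

theorem strictMono (hf : ∀ t, SmoothIncConcaveAt f t) : StrictMono f :=
  strictMono_of_deriv_pos fun t => (hf t).2.1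

/-- The part of `f` left of `T` extends to a function that is eventually `t ↦ t ^ b`. -/
theorem exists_extension_rpow (hf : ∀ t, SmoothIncConcaveAt f t) {T b : ℝ} (N : ℝ) (hT : 0 ≤ T)
    (hfT : 0 ≤ f T) (hb0 : 0 < b) (hb1 : b < 1) :
    ∃ (g : ℝ → ℝ) (S : ℝ), N ≤ S ∧ (∀ t, SmoothIncConcaveAt g t) ∧ (∀ t ≤ T, g t = f t) ∧
      ∀ t, S ≤ t → g t = t ^ b := by
  have hy : 0 ≤ f (T + 1) := hfT.trans (strictMono hf (by linarith)).le
  have hp : 0 < deriv f (T + 1) := (hf _).2.1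
  set p := deriv f (T + 1)
  obtain ⟨X, hX1, hX2, hX3, hX4⟩ : ∃ X : ℝ, max N (2 * T + 4) ≤ X ∧
      f (T + 1) / (1 - b) < X ^ b ∧ X ^ (-(1 - b)) < p / 2 ∧ 0 < X :=
    ((eventually_ge_atTop _).and (((tendsto_rpow_atTop hb0).eventually_gt_atTop _).and
      (((tendsto_rpow_neg_atTop (sub_pos.2 hb1)).eventually
        (eventually_lt_nhds (half_pos hp))).and (eventually_gt_atTop 0)))).exists
  have hXN := (le_max_left _ _).trans hX1
  have hXT := (le_max_right _ _).trans hX1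
  rw [div_lt_iff₀ (by linarith), mul_comm] at hX2
  have hmul : X ^ b = X * X ^ (b - 1) := by
    rw [Real.rpow_sub_one hX4.ne']
    field_simp
  rw [neg_sub] at hX3
  have hden : 0 < X - (T + 1) := by linarith
  have hXb : 0 < X ^ b := by positivity
  set q := (X ^ b - f (T + 1)) / (X - (T + 1)) with hq
  have hq0 : 0 < q := div_pos (by nlinarith) hden
  have hqp : q < p := by
    rw [hq, div_lt_iff₀ hden]
    nlinarith
  have hqb : b * X ^ (b - 1) < q := by
    rw [hq, lt_div_iff₀ hden]
    have : 0 < b * X ^ (b - 1) := by positivity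
    nlinarith
  have hqX : f (T + 1) + q * (X - (T + 1)) = X ^ b := by
    rw [hq]
    field_simp
    ring
  have hdL : ∀ t, deriv (fun t => f (T + 1) + q * (t - (T + 1))) t = q := fun t => by
    simp
  obtain ⟨w, hw, hwl, hwr⟩ := exists_smooth_corner (x := T + 1) (ε := 1 / 2) (by norm_num)
    (fun t _ => hf t) (fun t _ => affine hq0 (T + 1) (f (T + 1))) (by simp)
    (by rw [hdL]; exact hqp)
  have hwX : w =ᶠ[𝓝 X] fun t => f (T + 1) + q * (t - (T + 1)) := by
    filter_upwards [eventually_gt_nhds (show T + 2 < X by linarith)] with t ht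
    exact hwr t (by linarith)
  obtain ⟨g, hg, hgl, hgr⟩ := exists_smooth_corner (x := X) (ε := 1 / 2)
    (v := fun t => t ^ b) (by norm_num)
    (fun t _ => hw t) (fun t ht => rpow hb0 hb1.le (by linarith))
    (by rw [hwX.eq_of_nhds, hqX])
    (by rw [hwX.deriv_eq, hdL, Real.deriv_rpow_const]; exact hqb)
  refine ⟨g, X + 1 / 2, by linarith, hg, fun t ht => ?_, hgr⟩
  rw [hgl t (by linarith), hwl t (by linarith)]

theorem concaveOn (hf : ∀ t, SmoothIncConcaveAt f t) {D : Set ℝ} (hD : Convex ℝ D) :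
    ConcaveOn ℝ D f :=
  concaveOn_of_deriv2_nonpos' hD
    (fun t _ => (hf t).hasDerivAt.differentiableAt.differentiableWithinAt)
    (fun t _ => (hf t).hasDerivAt_deriv.differentiableAt.differentiableWithinAt)
    fun t _ => (hf t).2.2

/-- A smooth increasing concave function following prescribed powers on successive long
intervals. -/
theorem exists_forall_rpow_on_Icc {β : ℕ → ℝ} (hβ0 : ∀ k, 0 < β k) (hβ1 : ∀ k, β k < 1) :
    ∃ (f : ℝ → ℝ) (a s : ℕ → ℝ), (∀ t, SmoothIncConcaveAt f t) ∧ (∀ t ≤ 1, f t = t) ∧ a 0 = 1 ∧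
      ∀ k, (a k + 1) ^ 2 + 1 < s k ∧ (s k + 1) ^ 2 + 1 < a (k + 1) ∧
        ∀ t ∈ Icc (s k + 1) (a (k + 1) - 1), f t = t ^ β k := by
  let State := {p : (ℝ → ℝ) × ℝ // (∀ t, SmoothIncConcaveAt p.1 t) ∧ 1 ≤ p.2 ∧ p.1 0 = 0}
  have step : ∀ (p : State) (k : ℕ), ∃ (g : ℝ → ℝ) (S : ℝ), (p.1.2 + 1) ^ 2 + 2 ≤ S ∧
      (∀ t, SmoothIncConcaveAt g t) ∧ (∀ t ≤ p.1.2, g t = p.1.1 t) ∧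
      ∀ t, S ≤ t → g t = t ^ β k := fun ⟨p, hp, hp1, hp0⟩ k =>
    exists_extension_rpow hp ((p.2 + 1) ^ 2 + 2) (by linarith)
      (hp0.symm.le.trans ((strictMono hp).monotone (by linarith))) (hβ0 k) (hβ1 k)
  choose g S hS hg hgl hgr using step
  let p₀ : State := ⟨(id, 1), fun t => by
    simpa [Function.id_def] using affine (x := t) one_pos 0 0, le_rfl, rfl⟩
  let F : ℕ → State := fun k => Nat.rec p₀ (fun k p =>
    ⟨(g p k, (S p k + 1) ^ 2 + 2), hg p k, by nlinarith [sq_nonneg (S p k + 1)],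
      (hgl p k 0 (by linarith [p.2.2.1])).trans p.2.2.2⟩) k
  let a : ℕ → ℝ := fun k => (F k).1.2
  have ha1 : ∀ k, 1 ≤ a k := fun k => (F k).2.2.1
  have hsa : ∀ k, (S (F k) k + 1) ^ 2 + 2 = a (k + 1) := fun k => rfl
  have has : ∀ k, (a k + 1) ^ 2 + 2 ≤ S (F k) k := fun k => hS (F k) k
  have ha_succ : ∀ k, a k + 1 ≤ a (k + 1) := fun k => by
    nlinarith [has k, hsa k, ha1 k]
  have ha_mono : Monotone a := monotone_nat_of_le_succ fun k => by linarith [ha_succ k]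
  have ha_large : ∀ k : ℕ, (k : ℝ) + 1 ≤ a k := by
    intro k
    induction k with
    | zero => simpa using ha1 0
    | succ k ih =>
      push_cast
      linarith [ha_succ k]
  have hF : ∀ k n, k ≤ n → ∀ t ≤ a k, (F n).1.1 t = (F k).1.1 t := by
    intro k n hkn
    induction n, hkn using Nat.le_induction with
    | base => exact fun t _ => rfl
    | succ n hn ih =>
      exact fun t ht => (hgl (F n) n t (ht.trans (ha_mono hn))).trans (ih t ht)
  let f : ℝ → ℝ := fun t => (F ⌈t⌉₊).1.1 t
  have hf : ∀ k t, t ≤ a k → f t = (F k).1.1 t := by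
    intro k t ht
    rcases le_total k ⌈t⌉₊ with h | h
    · exact hF k _ h t ht
    · exact (hF _ k h t (by linarith [Nat.le_ceil t, ha_large ⌈t⌉₊])).symm
  refine ⟨f, a, fun k => S (F k) k, fun t => ?_, fun t ht => hf 0 t ht, rfl, fun k =>
    ⟨by linarith [has k], by linarith [hsa k], fun t ht => ?_⟩⟩
  · refine ((F ⌈t⌉₊).2.1 t).congr ?_
    filter_upwards [eventually_lt_nhds (show t < a ⌈t⌉₊ by
      linarith [Nat.le_ceil t, ha_large ⌈t⌉₊])] with y hy
    exact hf _ y hy.le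
  · rw [hf (k + 1) t (by linarith [ht.2])]
    exact hgr (F k) k t (by linarith [ht.1])

end SmoothIncConcaveAt

theorem stmt10 : ∃ (f : ℝ → ℝ) (R : ℕ → ℝ),
    ContDiffOn ℝ (⊤ : ℕ∞) f (Ici 0) ∧
    ConcaveOn ℝ (Ici 0) f ∧
    StrictMonoOn f (Ici 0) ∧
    (∀ t ∈ Ici (0:ℝ), 0 ≤ f t) ∧
    (∀ t ∈ Icc (0:ℝ) 1, f t = t) ∧
    R 0 = 1 ∧
    (∀ j : ℕ, (R j + 1) ^ 2 + 1 < R (j + 1)) ∧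
    ∀ l : ℕ, 1 ≤ l →
      (∀ t ∈ Icc (R (4 * l - 3) + 1) (R (4 * l - 2) - 1),
        f t = t ^ ((1 : ℝ) / ((l : ℝ) + 1))) ∧
      (∀ t ∈ Icc (R (4 * l - 1) + 1) (R (4 * l) - 1),
        f t = t ^ (1 - (1 : ℝ) / ((l : ℝ) + 1))) := by
  let β : ℕ → ℝ := fun k => if k % 2 = 0 then 1 / (((k / 2 : ℕ) : ℝ) + 2)
    else 1 - 1 / (((k / 2 : ℕ) : ℝ) + 2)
  have hβ : ∀ k, 0 < β k ∧ β k < 1 := by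
    intro k
    have h0 : (0 : ℝ) < 1 / (((k / 2 : ℕ) : ℝ) + 2) := by positivity
    have h1 : 1 / (((k / 2 : ℕ) : ℝ) + 2) < 1 := by
      rw [div_lt_one (by positivity)]
      linarith [Nat.cast_nonneg (α := ℝ) (k / 2)]
    simp only [β]
    split_ifs <;> constructor <;> linarith
  obtain ⟨f, a, s, hf, hid, ha0, has⟩ := SmoothIncConcaveAt.exists_forall_rpow_on_Icc
    (fun k => (hβ k).1) (fun k => (hβ k).2)
  have hmono := SmoothIncConcaveAt.strictMono hf
  refine ⟨f, fun j => if j % 2 = 0 then a (j / 2) else s (j / 2),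
    fun t _ => (hf t).1.contDiffWithinAt, SmoothIncConcaveAt.concaveOn hf (convex_Ici 0),
    hmono.strictMonoOn _, fun t ht => ?_, fun t ht => hid t ht.2, by simpa using ha0,
    fun j => ?_, fun l hl => ?_⟩
  · exact (hid 0 zero_le_one).symm.le.trans (hmono.monotone ht)
  · rcases Nat.even_or_odd' j with ⟨k, rfl | rfl⟩
    · have h1 : (2 * k + 1) % 2 ≠ 0 := by omega
      have h2 : (2 * k + 1) / 2 = k := by omega
      simpa [h1, h2] using (has k).1
    · have h1 : (2 * k + 1) % 2 ≠ 0 := by omega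
      have h2 : (2 * k + 1) / 2 = k := by omega
      have h3 : (2 * k + 1 + 1) % 2 = 0 := by omega
      have h4 : (2 * k + 1 + 1) / 2 = k + 1 := by omega
      simpa only [h1, h2, h3, h4, if_true, if_false] using (has k).2.1
  · obtain ⟨n, rfl⟩ := Nat.exists_eq_add_of_le' hl
    have hn : ((n + 1 : ℕ) : ℝ) + 1 = n + 2 := by
      push_cast
      ring
    rw [hn]
    constructor
    · have h1 : (4 * (n + 1) - 3) % 2 ≠ 0 := by omega
      have h2 : (4 * (n + 1) - 3) / 2 = 2 * n := by omega
      have h3 : (4 * (n + 1) - 2) % 2 = 0 := by omega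
      have h4 : (4 * (n + 1) - 2) / 2 = 2 * n + 1 := by omega
      have h5 : (2 * n) % 2 = 0 := by omega
      have h6 : (2 * n) / 2 = n := by omega
      have h7 : β (2 * n) = 1 / ((n : ℝ) + 2) := by
        simp only [β, h5, h6, if_true]
      have h8 := (has (2 * n)).2.2
      rw [h7] at h8
      simpa only [h1, h2, h3, h4, if_true, if_false] using h8
    · have h1 : (4 * (n + 1) - 1) % 2 ≠ 0 := by omega
      have h2 : (4 * (n + 1) - 1) / 2 = 2 * n + 1 := by omega
      have h3 : (4 * (n + 1)) % 2 = 0 := by omega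
      have h4 : (4 * (n + 1)) / 2 = 2 * n + 1 + 1 := by omega
      have h5 : (2 * n + 1) % 2 ≠ 0 := by omega
      have h6 : (2 * n + 1) / 2 = n := by omega
      have h7 : β (2 * n + 1) = 1 - 1 / ((n : ℝ) + 2) := by
        simp only [β, h5, h6, if_false]
      have h8 := (has (2 * n + 1)).2.2
      rw [h7] at h8
      simpa only [h1, h2, h3, h4, if_true, if_false] using h8
end

section
/- Let $(Y,y)$ be a proper, geodesic, nonbranching metric space which is noncompact. If the metric sphere $\partial B_R(y)=\{x: d(x,y)=R\}$ consists of a single point for some $R>0$, then $(Y,y)$ is isometric to $([0,\infty),a)$ for some $0\le a<R$, i.e. there is an isometry $Y\to[0,\infty)$ sending $y$ to $a$. -/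
open Set

/-- The curve `c` is a minimal unit-speed geodesic on `[0, T]`. -/
def IsMinGeodesic {Y : Type*} [MetricSpace Y] (c : ℝ → Y) (T : ℝ) : Prop :=
  ∀ s ∈ Icc (0:ℝ) T, ∀ t ∈ Icc (0:ℝ) T, dist (c s) (c t) = |s - t|

namespace IsMinGeodesic

variable {Y : Type*} [MetricSpace Y] {c e : ℝ → Y} {S T : ℝ}

lemma mono (hc : IsMinGeodesic c T) (h : S ≤ T) : IsMinGeodesic c S :=
  fun s hs t ht => hc s ⟨hs.1, hs.2.trans h⟩ t ⟨ht.1, ht.2.trans h⟩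

lemma dist_eq (hc : IsMinGeodesic c T) {s t : ℝ} (hs : 0 ≤ s) (hst : s ≤ t) (ht : t ≤ T) :
    dist (c s) (c t) = t - s := by
  rw [hc s ⟨hs, hst.trans ht⟩ t ⟨hs.trans hst, ht⟩, abs_sub_comm, abs_of_nonneg (by linarith)]

lemma continuousOn (hc : IsMinGeodesic c T) : ContinuousOn c (Icc 0 T) := by
  refine (LipschitzOnWith.of_dist_le_mul (K := 1) fun s hs t ht => ?_).continuousOn
  rw [hc s hs t ht, Real.dist_eq]
  simp

/-- Two minimal geodesics whose lengths add up to the distance of the outer endpoints concatenate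
to a minimal geodesic. -/
lemma concat (hc : IsMinGeodesic c S) (he : IsMinGeodesic e T)
    (hce : c S = e 0) (hd : dist (c 0) (e T) = S + T) :
    IsMinGeodesic (fun t => if t ≤ S then c t else e (t - S)) (S + T) := by
  have cross : ∀ s t, 0 ≤ s → s ≤ S → S < t → t ≤ S + T →
      dist (c s) (e (t - S)) = t - s := by
    intro s t h0 hs ht htT
    have h1 := hc.dist_eq le_rfl h0 hs
    have h2 := hc.dist_eq h0 hs le_rfl
    have h3 := he.dist_eq le_rfl (by linarith : 0 ≤ t - S) (by linarith)
    have h4 := he.dist_eq (by linarith : 0 ≤ t - S) (by linarith : t - S ≤ T) le_rfl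
    have h5 := dist_triangle (c s) (c S) (e (t - S))
    have h6 := dist_triangle4 (c 0) (c s) (e (t - S)) (e T)
    rw [hce] at h2 h5
    linarith
  intro s hs t ht
  dsimp only
  split_ifs with h1 h2 h2
  · exact hc s ⟨hs.1, h1⟩ t ⟨ht.1, h2⟩
  · push Not at h2
    rw [cross s t hs.1 h1 h2 ht.2, abs_sub_comm, abs_of_nonneg (by linarith)]
  · push Not at h1
    rw [dist_comm, cross t s ht.1 h2 h1 hs.2, abs_of_nonneg (by linarith)]
  · push Not at h1 h2
    rw [he _ ⟨by linarith, by linarith [hs.2]⟩ _ ⟨by linarith, by linarith [ht.2]⟩]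
    congr 1
    ring

end IsMinGeodesic

/-- In a nonbranching geodesic space, points `x` and `z` that can be reached from `p` by minimal
geodesics through a common point `q ≠ p` lie on a common minimal geodesic issuing from `q`. -/
lemma dist_eq_abs_sub_of_nonbranching {Y : Type*} [MetricSpace Y]
    (hgeo : ∀ x z : Y, ∃ c : ℝ → Y, c 0 = x ∧ c (dist x z) = z ∧ IsMinGeodesic c (dist x z))
    (hnb : ∀ (T : ℝ) (c₁ c₂ : ℝ → Y), IsMinGeodesic c₁ T → IsMinGeodesic c₂ T →
      (∃ ε > (0:ℝ), ∀ t ∈ Icc (0:ℝ) ε, c₁ t = c₂ t) → ∀ t ∈ Icc (0:ℝ) T, c₁ t = c₂ t)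
    {p q x z : Y} (hpq : p ≠ q) (hx : dist p x = dist p q + dist q x)
    (hz : dist p z = dist p q + dist q z) :
    dist x z = |dist q x - dist q z| := by
  wlog h : dist q x ≤ dist q z generalizing x z
  · rw [dist_comm x z, abs_sub_comm]
    exact this hz hx (le_of_not_ge h)
  obtain ⟨c, hc0, hc1, hc⟩ := hgeo p q
  obtain ⟨e, he0, he1, he⟩ := hgeo q x
  obtain ⟨f, hf0, hf1, hf⟩ := hgeo q z
  have hpos : 0 < dist p q := dist_pos.2 hpq
  have key := hnb (dist p q + dist q x) _ _
    (hc.concat he (hc1.trans he0.symm) (by rw [hc0, he1, hx]))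
    ((hc.concat hf (hc1.trans hf0.symm) (by rw [hc0, hf1, hz])).mono
      (by linarith))
    ⟨dist p q, hpos, fun t ht => by simp [ht.2]⟩ (dist p q + dist q x)
    ⟨by positivity, le_rfl⟩
  have hxf : x = f (dist q x) := by
    rcases (dist_nonneg (x := q) (y := x)).eq_or_lt with h0 | h0
    · rw [← h0, hf0]
      exact (dist_eq_zero.1 h0.symm).symm
    · simpa [not_le.2 h0, he1] using key
  have := hf.dist_eq dist_nonneg h le_rfl
  rw [← hxf, hf1] at this
  rw [this, abs_sub_comm, abs_of_nonneg (by linarith)]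

/-- If a metric sphere is a single point, then minimal geodesics crossing it pass through that
point. -/
lemma dist_eq_add_of_sphere_eq_singleton {Y : Type*} [MetricSpace Y]
    (hgeo : ∀ x z : Y, ∃ c : ℝ → Y, c 0 = x ∧ c (dist x z) = z ∧ IsMinGeodesic c (dist x z))
    {y q : Y} {R : ℝ} (hsphere : {x : Y | dist x y = R} = {q}) {x z : Y}
    (hx : dist x y ≤ R) (hz : R ≤ dist z y) :
    dist x z = dist x q + dist q z := by
  obtain ⟨c, hc0, hc1, hc⟩ := hgeo x z
  obtain ⟨t, ht, htR⟩ := intermediate_value_Icc (f := fun t => dist (c t) y)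
    (dist_nonneg (x := x) (y := z))
    (continuous_dist.comp_continuousOn (hc.continuousOn.prodMk continuousOn_const))
    (show R ∈ _ by simpa [hc0, hc1] using ⟨hx, hz⟩)
  have hq : c t = q := by
    have : c t ∈ {x : Y | dist x y = R} := htR
    rwa [hsphere] at this
  have h1 := hc.dist_eq le_rfl ht.1 ht.2
  have h2 := hc.dist_eq ht.1 ht.2 le_rfl
  rw [hc0, hq] at h1
  rw [hc1, hq] at h2
  linarith

lemma exists_lt_dist_of_noncompact {Y : Type*} [MetricSpace Y] [ProperSpace Y]
    (hnc : ¬ CompactSpace Y) (y : Y) (r : ℝ) : ∃ p, r < dist p y := by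
  by_contra! h
  refine hnc ⟨?_⟩
  rw [← Set.eq_univ_of_forall (s := Metric.closedBall y r) h]
  exact isCompact_closedBall y r

theorem stmt14 {Y : Type*} [MetricSpace Y] [ProperSpace Y] (y : Y)
    (hgeo : ∀ x z : Y, ∃ c : ℝ → Y, c 0 = x ∧ c (dist x z) = z ∧
      ∀ s ∈ Icc (0:ℝ) (dist x z), ∀ t ∈ Icc (0:ℝ) (dist x z),
        dist (c s) (c t) = |s - t|)
    (hnb : ∀ (T : ℝ) (c₁ c₂ : ℝ → Y),
      (∀ s ∈ Icc (0:ℝ) T, ∀ t ∈ Icc (0:ℝ) T, dist (c₁ s) (c₁ t) = |s - t|) →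
      (∀ s ∈ Icc (0:ℝ) T, ∀ t ∈ Icc (0:ℝ) T, dist (c₂ s) (c₂ t) = |s - t|) →
      (∃ ε > (0:ℝ), ∀ t ∈ Icc (0:ℝ) ε, c₁ t = c₂ t) →
      ∀ t ∈ Icc (0:ℝ) T, c₁ t = c₂ t)
    (hnc : ¬ CompactSpace Y)
    (R : ℝ) (hR : 0 < R) (x₀ : Y) (hsphere : {x : Y | dist x y = R} = {x₀}) :
    ∃ a : ℝ, 0 ≤ a ∧ a < R ∧
      ∃ φ : Y → ℝ, Isometry φ ∧ φ y = a ∧ Set.range φ = Ici 0 := by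
  have through : ∀ {x z : Y}, dist x y ≤ R → R ≤ dist z y → dist x z = dist x x₀ + dist x₀ z :=
    fun hx hz => dist_eq_add_of_sphere_eq_singleton hgeo hsphere hx hz
  have hx₀ : dist x₀ y = R := by
    have : x₀ ∈ {x : Y | dist x y = R} := hsphere ▸ rfl
    exact this
  have hyy : dist y y ≤ R := by simpa using hR.le
  obtain ⟨p, hp⟩ := exists_lt_dist_of_noncompact hnc y R
  have hpx₀ : p ≠ x₀ := fun h => hp.ne' (h ▸ hx₀)
  have hyx₀ : y ≠ x₀ := fun h => hR.ne (by rw [← hx₀, ← h, dist_self])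
  obtain ⟨m, hm, hmax⟩ := (isCompact_closedBall y R).exists_isMaxOn
    ⟨y, Metric.mem_closedBall_self hR.le⟩
    (f := fun x => dist x₀ x) (by fun_prop)
  rw [Metric.mem_closedBall] at hm
  replace hmax : ∀ x, dist x y ≤ R → dist x₀ x ≤ dist x₀ m := fun x hx => hmax hx
  let φ : Y → ℝ := fun x => if dist x y ≤ R then dist x₀ m - dist x₀ x else dist x₀ m + dist x₀ x
  have φ_in : ∀ {x}, dist x y ≤ R → φ x = dist x₀ m - dist x₀ x := fun h => if_pos h
  have φ_out : ∀ {x}, R < dist x y → φ x = dist x₀ m + dist x₀ x := fun h => if_neg h.not_ge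
  have hφ : Isometry φ := by
    refine Isometry.of_dist_eq fun x z => ?_
    rw [Real.dist_eq]
    rcases le_or_gt (dist x y) R with hx | hx <;> rcases le_or_gt (dist z y) R with hz | hz
    · have h (w : Y) (hw : dist w y ≤ R) : dist p w = dist p x₀ + dist x₀ w := by
        rw [dist_comm p w, through hw hp.le, dist_comm w, dist_comm p, add_comm]
      rw [φ_in hx, φ_in hz, dist_eq_abs_sub_of_nonbranching hgeo hnb hpx₀ (h x hx) (h z hz),
        abs_sub_comm]
      congr 1
      ring
    · rw [φ_in hx, φ_out hz, through hx hz.le, dist_comm x, abs_sub_comm, abs_of_nonneg]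
      · ring
      · linarith [dist_nonneg (x := x₀) (y := x), dist_nonneg (x := x₀) (y := z)]
    · rw [φ_out hx, φ_in hz, dist_comm x, through hz hx.le, dist_comm z, abs_of_nonneg]
      · ring
      · linarith [dist_nonneg (x := x₀) (y := x), dist_nonneg (x := x₀) (y := z)]
    · rw [φ_out hx, φ_out hz, dist_eq_abs_sub_of_nonbranching hgeo hnb hyx₀
        (through hyy hx.le) (through hyy hz.le)]
      congr 1
      ring
  have φ_m : φ m = 0 := by rw [φ_in hm, sub_self]
  refine ⟨dist x₀ m - R, by linarith [hmax y hyy], ?_, φ, hφ, by rw [φ_in hyy, hx₀], ?_⟩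
  · rcases hm.eq_or_lt with h | h
    · have : m ∈ {x : Y | dist x y = R} := h
      rw [hsphere, mem_singleton_iff] at this
      rw [this, dist_self]
      linarith
    · linarith [dist_triangle_right x₀ m y]
  · refine Subset.antisymm ?_ fun t ht => ?_
    · rintro _ ⟨x, rfl⟩
      rcases le_or_gt (dist x y) R with hx | hx
      · rw [φ_in hx, mem_Ici]
        linarith [hmax x hx]
      · rw [φ_out hx, mem_Ici]
        positivity
    · obtain ⟨z, hz⟩ := exists_lt_dist_of_noncompact hnc y (R + t)
      rw [mem_Ici] at ht
      have hzt : t ≤ φ z := by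
        rw [φ_out (by linarith)]
        linarith [dist_triangle_left z y x₀, dist_nonneg (x := x₀) (y := m)]
      obtain ⟨c, hc0, hc1, hc⟩ := hgeo m z
      obtain ⟨s, -, hs⟩ := intermediate_value_Icc (f := fun s => φ (c s))
        (dist_nonneg (x := m) (y := z))
        (hφ.continuous.comp_continuousOn (IsMinGeodesic.continuousOn hc))
        (show t ∈ _ by simpa [hc0, hc1, φ_m] using ⟨ht, hzt⟩)
      exact ⟨c s, hs⟩
end
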